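/- Let α be a cascading n-sequence and RC(α) = (ν₁, ..., ν_n). Then for every l in {1, ..., n}, the number of strings (rows) of ν_l is at most min(n - l + 1, l). -/

import Mathlib

namespace CascRC

abbrev RP := Multiset (ℕ × ℤ)
abbrev RC := ℕ → RP

/-- The Cartan matrix of type `A`. -/
def cartanA (a b : ℕ) : ℤ :=
  if a = b then 2 else if b = a + 1 ∨ a = b + 1 then -1 else 0

/-- The smallest rigging of a rigged partition (0 if empty). -/
noncomputable def minRig (ν : RP) : ℤ :=
  if h : ν = 0 then 0
  else (ν.map Prod.snd).toFinset.min'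
    (Multiset.toFinset_nonempty.mpr (by simpa [Multiset.map_eq_zero] using h))

/-- The greatest length of a string whose rigging is the smallest rigging. -/
noncomputable def selLen (ν : RP) : ℕ :=
  ((ν.filter (fun s => s.2 = minRig ν)).map Prod.fst).sup

/-- The Kashiwara operator `f_a` on rigged configurations. -/
noncomputable def fOp (a : ℕ) (R : RC) : RC :=
  if R a = 0 ∨ 0 < minRig (R a) then
    fun b => (if b = a then ({(1, -1)} : RP) else 0)
      + (R b).map (fun s => if 0 < s.1 then (s.1, s.2 - cartanA a b) else s)
  else
    fun b =>
      (if b = a then ({(selLen (R a) + 1, minRig (R a) - 1)} : RP) else 0)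
      + ((if b = a then (R a).erase (selLen (R a), minRig (R a)) else R b).map
          (fun s => if selLen (R a) < s.1 then (s.1, s.2 - cartanA a b) else s))

/-- A list `γ` acts by `f_γ = f_{γ_p} ∘ ⋯ ∘ f_{γ₁}`. -/
noncomputable def fList (γ : List ℕ) (R : RC) : RC :=
  γ.foldl (fun S a => fOp a S) R

def emptyRC : RC := fun _ => 0

/-- `RC(α)`: the result of the list `α` acting on the empty rigged configuration. -/
noncomputable def RCseq (α : List ℕ) : RC := fList α emptyRC

/-- The `m`-lower subinterval `(a, a+1, …, m)`. -/
def lowerInt (a m : ℕ) : List ℕ := List.range' a (m + 1 - a)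

def IsLowerIv (n : ℕ) (p : ℕ × ℕ) : Prop := 1 ≤ p.1 ∧ p.1 ≤ p.2 ∧ p.2 ≤ n

/-- Ordering between consecutive lower subintervals in a cascading sequence. -/
def CascCh (p q : ℕ × ℕ) : Prop := q.2 < p.2 ∨ (q.2 = p.2 ∧ p.1 ≤ q.1)

/-- `ivs` is the lower-subinterval decomposition of a cascading `n`-sequence. -/
def IsCascDecomp (n : ℕ) (ivs : List (ℕ × ℕ)) : Prop :=
  (∀ p ∈ ivs, IsLowerIv n p) ∧ ivs.Chain' CascCh

/-- The integer sequence determined by a decomposition into lower subintervals. -/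
def seqOf (ivs : List (ℕ × ℕ)) : List ℕ :=
  (ivs.map (fun p => lowerInt p.1 p.2)).flatten

/-- `R_k`: the rigged configuration corresponding to `I_1 ⋯ I_k`. -/
noncomputable def Rk (ivs : List (ℕ × ℕ)) (k : ℕ) : RC :=
  RCseq (seqOf (ivs.take k))

/-- Height of column `c` of (the underlying partition of) a rigged partition. -/
def colHt (ν : RP) (c : ℕ) : ℕ := (ν.filter (fun s => c ≤ s.1)).card

/-- Length of the `i`-th row (1-based) of the underlying partition. -/
def rowLen (ν : RP) (i : ℕ) : ℕ :=
  ((Finset.Icc 1 ((ν.map Prod.fst).sup)).filter (fun c => i ≤ colHt ν c)).card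

/-- Length of the uppermost row of length at most `L` (0 for the virtual empty row). -/
def upRowLen (ν : RP) (L : ℕ) : ℕ := rowLen ν (colHt ν (L + 1) + 1)

/-- The column to which an application of `f_a` adds a box. -/
noncomputable def selCol (a : ℕ) (R : RC) : ℕ :=
  if R a = 0 ∨ 0 < minRig (R a) then 1 else selLen (R a) + 1

/-- Given a lower subinterval `p = (a, m)` acting on `R`, the column to which the
operator `f_l` occurring in it adds a box in the `l`-th partition. -/
noncomputable def ivCol (p : ℕ × ℕ) (l : ℕ) (R : RC) : ℕ :=
  selCol l (fList (lowerInt p.1 (l - 1)) R)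

/-- Lengths `|r_a|, |r_{a+1}|, …` of the rows `r_i` of Lemma "snake":
`rLenSeq R a (i - a) = |r_i|`. -/
def rLenSeq (R : RC) (a : ℕ) : ℕ → ℕ
  | 0 => rowLen (R a) 1
  | k + 1 => upRowLen (R (a + k + 1)) (rLenSeq R a k)


/-- The greatest length at most `L` of a string of `ν` (0 if there is none). -/
def rowBelow (ν : RP) (L : ℕ) : ℕ := ((ν.map Prod.fst).filter (· ≤ L)).sup

theorem rowBelow_le (ν : RP) (L : ℕ) : rowBelow ν L ≤ L := by
  simp only [rowBelow, Multiset.sup_le, Multiset.mem_filter]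
  exact fun b hb => hb.2

theorem le_rowBelow {ν : RP} {L : ℕ} {s : ℕ × ℤ} (hs : s ∈ ν) (h : s.1 ≤ L) :
    s.1 ≤ rowBelow ν L :=
  Multiset.le_sup (Multiset.mem_filter.2 ⟨Multiset.mem_map_of_mem _ hs, h⟩)

theorem multiset_sup_eq_zero_or_mem (M : Multiset ℕ) : M.sup = 0 ∨ M.sup ∈ M := by
  induction M using Multiset.induction with
  | empty => left; rfl
  | cons a M ih =>
    rw [Multiset.sup_cons]
    rcases le_total a M.sup with h | h
    · rw [sup_eq_right.2 h]
      exact ih.imp_right Multiset.mem_cons_of_mem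
    · rw [sup_eq_left.2 h]
      exact Or.inr (Multiset.mem_cons_self _ _)

theorem rowBelow_eq_zero_or (ν : RP) (L : ℕ) :
    rowBelow ν L = 0 ∨ ∃ y, (rowBelow ν L, y) ∈ ν := by
  refine (multiset_sup_eq_zero_or_mem _).imp_right fun h => ?_
  obtain ⟨⟨c, y⟩, hs, hc⟩ := Multiset.mem_map.1 (Multiset.mem_filter.1 h).1
  exact ⟨y, by rw [rowBelow, ← hc]; exact hs⟩

theorem colHt_anti (ν : RP) {c d : ℕ} (h : c ≤ d) : colHt ν d ≤ colHt ν c :=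
  Multiset.card_le_card (Multiset.monotone_filter_right _ fun _ hs => h.trans hs)

theorem colHt_cons (s : ℕ × ℤ) (ν : RP) (c : ℕ) :
    colHt (s ::ₘ ν) c = colHt ν c + if c ≤ s.1 then 1 else 0 := by
  unfold colHt
  split_ifs with h <;> simp [h]

theorem colHt_map (ν : RP) (g : ℕ × ℤ → ℕ × ℤ) (hg : ∀ s, (g s).1 = s.1) (c : ℕ) :
    colHt (ν.map g) c = colHt ν c := by
  simp [colHt, Multiset.filter_map, hg]

theorem colHt_succ_lt {ν : RP} {c : ℕ} {y : ℤ} (h : (c, y) ∈ ν) :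
    colHt ν (c + 1) + 1 ≤ colHt ν c := by
  obtain ⟨μ, rfl⟩ := Multiset.exists_cons_of_mem h
  have := colHt_anti μ (Nat.le_succ c)
  simp only [colHt_cons]
  simp
  exact this

theorem colHt_eq_of_forall {ν : RP} {c d : ℕ} (hcd : c ≤ d)
    (h : ∀ s ∈ ν, c ≤ s.1 → d ≤ s.1) : colHt ν c = colHt ν d := by
  unfold colHt
  rw [Multiset.filter_congr fun s hs => ⟨h s hs, hcd.trans⟩]

theorem le_of_colHt_le {ν : RP} {c d : ℕ} (hcd : c ≤ d) (h : colHt ν c ≤ colHt ν d) :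
    ∀ s ∈ ν, c ≤ s.1 → d ≤ s.1 := by
  have h1 : ν.filter (fun s => d ≤ s.1) ≤ ν.filter (fun s => c ≤ s.1) :=
    Multiset.monotone_filter_right _ fun _ hs => hcd.trans hs
  have h2 := Multiset.eq_of_le_of_card_le h1 h
  intro s hs hc
  have : s ∈ ν.filter (fun s => c ≤ s.1) := Multiset.mem_filter.2 ⟨hs, hc⟩
  rw [← h2] at this
  exact (Multiset.mem_filter.1 this).2

theorem colHt_one {ν : RP} (h : ∀ s ∈ ν, 0 < s.1) : colHt ν 1 = ν.card := by
  exact congrArg Multiset.card (Multiset.filter_eq_self.2 h)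

theorem colHt_eq_zero_of_forall_lt {ν : RP} {c : ℕ} (h : ∀ s ∈ ν, s.1 < c) :
    colHt ν c = 0 := by
  rw [colHt, Multiset.card_eq_zero, Multiset.filter_eq_nil]
  exact fun s hs => not_le.2 (h s hs)

theorem minRig_eq {ν : RP} {r : ℕ} {x : ℤ} (hm : (r, x) ∈ ν) (h : ∀ s ∈ ν, x ≤ s.2) :
    minRig ν = x := by
  have hne : ν ≠ 0 := fun h0 => by simp [h0] at hm
  rw [minRig, dif_neg hne]
  refine le_antisymm (Finset.min'_le _ _ ?_) (Finset.le_min' _ _ _ ?_)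
  · simpa using ⟨r, hm⟩
  · intro y hy
    simp only [Multiset.mem_toFinset, Multiset.mem_map] at hy
    obtain ⟨s, hs, rfl⟩ := hy
    exact h s hs

theorem minRig_pos {ν : RP} (hne : ν ≠ 0) (h : ∀ s ∈ ν, 0 < s.2) : 0 < minRig ν := by
  rw [minRig, dif_neg hne, Finset.lt_min'_iff]
  intro y hy
  simp only [Multiset.mem_toFinset, Multiset.mem_map] at hy
  obtain ⟨s, hs, rfl⟩ := hy
  exact h s hs

theorem selLen_eq {ν : RP} {r : ℕ} {x : ℤ} (hm : (r, x) ∈ ν)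
    (h : ∀ s ∈ ν, x ≤ s.2 ∧ (s.2 = x → s.1 ≤ r)) : selLen ν = r := by
  rw [selLen, minRig_eq hm fun s hs => (h s hs).1]
  refine le_antisymm (Multiset.sup_le.2 fun b hb => ?_) (Multiset.le_sup ?_)
  · obtain ⟨s, hs, rfl⟩ := Multiset.mem_map.1 hb
    obtain ⟨hs, hx⟩ := Multiset.mem_filter.1 hs
    exact (h s hs).2 hx
  · exact Multiset.mem_map.2 ⟨(r, x), Multiset.mem_filter.2 ⟨hm, rfl⟩, rfl⟩

/-- `f_a` extends a string of length `r` and rigging `x` of `ν`; `r = x = 0` stands for the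
creation of a new string. -/
def Selects (ν : RP) (r : ℕ) (x : ℤ) : Prop :=
  (r = 0 ∧ x = 0 ∧ ∀ s ∈ ν, 0 < s.2) ∨
    ((r, x) ∈ ν ∧ x ≤ 0 ∧ ∀ s ∈ ν, x ≤ s.2 ∧ (s.2 = x → s.1 ≤ r))

theorem fOp_eq {a : ℕ} {R : RC} {r : ℕ} {x : ℤ} (hpos : ∀ s ∈ R a, 0 < s.1)
    (h : Selects (R a) r x) :
    fOp a R = fun b => (if b = a then ({(r + 1, x - 1)} : RP) else 0)
      + ((if b = a then (R a).erase (r, x) else R b).map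
          (fun s => if r < s.1 then (s.1, s.2 - cartanA a b) else s)) := by
  rcases h with ⟨rfl, rfl, h⟩ | ⟨hm, hx, h⟩
  · have h0 : R a = 0 ∨ 0 < minRig (R a) := by
      by_cases hne : R a = 0
      · exact Or.inl hne
      · exact Or.inr (minRig_pos hne h)
    have he : (R a).erase (0, 0) = R a :=
      Multiset.erase_of_notMem fun hmem => by simpa using hpos _ hmem
    rw [fOp, if_pos h0, he]
    funext b
    by_cases hb : b = a
    · subst hb; simp
    · simp [hb]
  · have hmin := minRig_eq hm fun s hs => (h s hs).1
    have h0 : ¬ (R a = 0 ∨ 0 < minRig (R a)) := by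
      rintro (h0 | h0)
      · simp [h0] at hm
      · omega
    rw [fOp, if_neg h0, hmin, selLen_eq hm h]

/-- Increase by one the rigging of every string of length greater than `L`. -/
def bump (L : ℕ) (ν : RP) : RP := ν.map fun s => if L < s.1 then (s.1, s.2 + 1) else s

theorem colHt_bump (L : ℕ) (ν : RP) (c : ℕ) : colHt (bump L ν) c = colHt ν c :=
  colHt_map _ _ (fun s => by split_ifs <;> rfl) c

theorem bump_pos {L : ℕ} {ν : RP} (h : ∀ s ∈ ν, 0 < s.1) : ∀ s ∈ bump L ν, 0 < s.1 := by
  intro s hs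
  obtain ⟨t, ht, rfl⟩ := Multiset.mem_map.1 hs
  have := h t ht
  split_ifs <;> exact this

theorem bump_eq_self {L : ℕ} {ν : RP} (h : ∀ s ∈ ν, s.1 ≤ L) : bump L ν = ν := by
  rw [bump, Multiset.map_congr rfl fun s hs => if_neg (not_lt.2 (h s hs)), Multiset.map_id']

/-- Riggings of `ν` are at least `x`, with equality for the strings of length at least `T`. -/
structure Level (ν : RP) (x : ℤ) (T : ℕ) : Prop where
  nonpos : x ≤ 0
  ge : ∀ s ∈ ν, x ≤ s.2
  eq : ∀ s ∈ ν, T ≤ s.1 → s.2 = x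
  zero : T = 0 → x = 0

theorem Level.selects {ν : RP} {x : ℤ} {T L : ℕ} (h : Level ν x T) (hpos : ∀ s ∈ ν, 0 < s.1)
    (hT : T ≤ rowBelow ν L) : Selects (bump L ν) (rowBelow ν L) x := by
  have hL := rowBelow_le ν L
  by_cases h0 : rowBelow ν L = 0
  · have hT0 : T = 0 := by omega
    have hx := h.zero hT0
    refine Or.inl ⟨h0, hx, fun s hs => ?_⟩
    obtain ⟨t, ht, rfl⟩ := Multiset.mem_map.1 hs
    have h1 := h.eq t ht (by omega)
    have h2 := hpos t ht
    have h3 : L < t.1 := by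
      by_contra hc
      have := le_rowBelow ht (not_lt.1 hc)
      omega
    rw [if_pos h3]
    simp only
    omega
  · obtain ⟨y, hy⟩ := (rowBelow_eq_zero_or ν L).resolve_left h0
    have hyx : y = x := h.eq _ hy hT
    subst hyx
    refine Or.inr ⟨Multiset.mem_map.2 ⟨_, hy, if_neg (not_lt.2 hL)⟩, h.nonpos, fun s hs => ?_⟩
    obtain ⟨t, ht, rfl⟩ := Multiset.mem_map.1 hs
    have h1 := h.ge t ht
    split_ifs with h3
    · have h2 := h.eq t ht (by omega)
      simp only
      omega
    · exact ⟨h1, fun _ => le_rowBelow ht (not_lt.1 h3)⟩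

section Step

variable {l : ℕ} {S : RC} {r : ℕ} {x : ℤ}

theorem colHt_fOp (hpos : ∀ s ∈ S l, 0 < s.1) (h : Selects (S l) r x) (b c : ℕ) (hc : 1 ≤ c) :
    colHt (fOp l S b) c = colHt (S b) c + if b = l ∧ c = r + 1 then 1 else 0 := by
  rw [fOp_eq hpos h]
  have hg : ∀ s : ℕ × ℤ, (if r < s.1 then (s.1, s.2 - cartanA l b) else s).1 = s.1 := by
    intro s; split_ifs <;> rfl
  by_cases hb : b = l
  · subst hb
    simp only [if_true, Multiset.singleton_add, colHt_cons, colHt_map _ _ hg, true_and]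
    by_cases hm : (r, x) ∈ S b
    · conv_rhs => rw [← Multiset.cons_erase hm, colHt_cons]
      split_ifs <;> omega
    · rw [Multiset.erase_of_notMem hm]
      have hr : r = 0 := by
        rcases h with h | h
        · exact h.1
        · exact absurd h.1 hm
      split_ifs <;> omega
  · simp [hb, colHt_map _ _ hg]

theorem fOp_pos (hpos : ∀ b, ∀ s ∈ S b, 0 < s.1) (h : Selects (S l) r x) :
    ∀ b, ∀ s ∈ fOp l S b, 0 < s.1 := by
  intro b s hs
  rw [fOp_eq (hpos l) h] at hs
  rcases Multiset.mem_add.1 hs with hs | hs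
  · split_ifs at hs
    · rw [Multiset.mem_singleton.1 hs]; exact Nat.succ_pos r
    · simp at hs
  · obtain ⟨t, ht, rfl⟩ := Multiset.mem_map.1 hs
    have : 0 < t.1 := by
      split_ifs at ht with hb
      · exact hpos l t (Multiset.mem_of_mem_erase ht)
      · exact hpos b t ht
    split_ifs <;> exact this

theorem fOp_far (hpos : ∀ s ∈ S l, 0 < s.1) (h : Selects (S l) r x) {b : ℕ} (h1 : b ≠ l)
    (h2 : b ≠ l + 1) (h3 : l ≠ b + 1) : fOp l S b = S b := by
  rw [fOp_eq hpos h]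
  simp [h1, h2, h3, cartanA, Ne.symm h1]

theorem fOp_adj (hpos : ∀ s ∈ S l, 0 < s.1) (h : Selects (S l) r x) {b : ℕ}
    (hb : b = l + 1 ∨ l = b + 1) : fOp l S b = bump r (S b) := by
  rw [fOp_eq hpos h]
  have h1 : b ≠ l := by omega
  have hA : cartanA l b = -1 := by
    rw [cartanA, if_neg (Ne.symm h1), if_pos hb]
  simp only [if_neg h1, hA, zero_add, sub_neg_eq_add, bump]

theorem fOp_self {ν : RP} {T L : ℕ} (hS : S l = bump L ν) (hpos : ∀ s ∈ ν, 0 < s.1)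
    (h : Level ν x T) (hT : T ≤ rowBelow ν L) : ∀ s ∈ fOp l S l,
      (rowBelow ν L < s.1 → s.2 = x - 1) ∧ (s.1 ≤ rowBelow ν L → s ∈ ν) := by
  have hsel := h.selects hpos hT
  rw [← hS] at hsel
  intro s hs
  rw [fOp_eq (hS ▸ bump_pos hpos) hsel] at hs
  simp only [if_true, Multiset.singleton_add, Multiset.mem_cons] at hs
  rcases hs with rfl | hs
  · exact ⟨fun _ => rfl, fun hle => absurd hle (by simp)⟩
  · obtain ⟨t, ht, rfl⟩ := Multiset.mem_map.1 hs
    have ht := Multiset.mem_of_mem_erase ht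
    rw [hS] at ht
    obtain ⟨u, hu, rfl⟩ := Multiset.mem_map.1 ht
    have hA : cartanA l l = 2 := by simp [cartanA]
    have hL := rowBelow_le ν L
    rw [hA]
    by_cases h1 : L < u.1
    · have h2 := h.eq u hu (by omega)
      have h3 : rowBelow ν L < u.1 := by omega
      simp only [if_pos h1, if_pos h3]
      exact ⟨fun _ => by omega, fun h4 => by omega⟩
    · have h2 := le_rowBelow hu (not_lt.1 h1)
      simp only [if_neg h1, if_neg (not_lt.2 h2)]
      exact ⟨fun h4 => by omega, fun _ => hu⟩

end Step

/-- The invariant of a rigged configuration obtained from a cascading sequence whose last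
lower subinterval is `(a, …, m)`: `T l` is the length of the row of `ν_l` extended last in the
`m`-component (after the extension), or 0 if that component is
still empty. -/
structure Stable (n m a : ℕ) (T : ℕ → ℕ) (x : ℤ) (R : RC) : Prop where
  pos : ∀ b, ∀ s ∈ R b, 0 < s.1
  interlace : ∀ l < m, ∀ c, 1 ≤ c →
    colHt (R l) c ≤ colHt (R (l + 1)) c ∧ colHt (R (l + 1)) c ≤ colHt (R l) c + 1
  rig_zero : ∀ l < m, ∀ s ∈ R l, s.2 = 0
  level : Level (R m) x (T m)
  row_mem : ∀ l, a ≤ l → l ≤ m → T l = 0 ∨ ∃ y, (T l, y) ∈ R l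
  row_anti : ∀ l, a ≤ l → l < m → T (l + 1) ≤ T l
  rows_le : ∀ l, colHt (R l) 1 ≤ l
  rows_le_sub : ∀ l, l ≤ n → colHt (R l) 1 + max l m ≤ n + 1
  rows_fresh : ∀ l, a ≤ l → l ≤ m → T l = 0 → colHt (R l) 1 + m ≤ n

theorem stable_empty (n : ℕ) : Stable n n 0 (fun _ => 0) 0 emptyRC := by
  constructor <;> simp [emptyRC, colHt]
  · constructor <;> simp
  · omega

theorem Stable.descend {n m a : ℕ} {T : ℕ → ℕ} {x : ℤ} {R : RC} (h : Stable n m a T x R)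
    {m' : ℕ} (hm : m' < m) (hn : m ≤ n) : Stable n m' 0 (fun _ => 0) 0 R where
  pos := h.pos
  interlace l hl := h.interlace l (hl.trans hm)
  rig_zero l hl := h.rig_zero l (hl.trans hm)
  level := ⟨le_rfl, fun s hs => (h.rig_zero m' hm s hs).ge,
    fun s hs _ => h.rig_zero m' hm s hs, fun _ => rfl⟩
  row_mem _ _ _ := Or.inl rfl
  row_anti _ _ _ := le_rfl
  rows_le := h.rows_le
  rows_le_sub l hl := by have := h.rows_le_sub l hl; omega
  rows_fresh l _ hl _ := by have := h.rows_le_sub l (by omega); omega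

/-- The greatest length of a string. -/
def topLen (ν : RP) : ℕ := (ν.map Prod.fst).sup

theorem le_topLen {ν : RP} {s : ℕ × ℤ} (hs : s ∈ ν) : s.1 ≤ topLen ν :=
  Multiset.le_sup (Multiset.mem_map_of_mem _ hs)

/-- The length of the row of `ν_l` extended by a lower subinterval starting at `a`. -/
def snake (R : RC) (a : ℕ) : ℕ → ℕ
  | 0 => 0
  | l + 1 => rowBelow (R (l + 1)) (if l + 1 ≤ a then topLen (R (l + 1)) else snake R a l)

theorem snake_start {R : RC} {a : ℕ} (ha : 1 ≤ a) :
    snake R a a = rowBelow (R a) (topLen (R a)) := by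
  obtain ⟨k, rfl⟩ := Nat.exists_eq_add_of_le' ha
  simp [snake]

theorem snake_succ {R : RC} {a l : ℕ} (h : a ≤ l) :
    snake R a (l + 1) = rowBelow (R (l + 1)) (snake R a l) := by
  rw [snake, if_neg (by omega)]

theorem snake_eq_zero_or (R : RC) (a l : ℕ) :
    snake R a l = 0 ∨ ∃ y, (snake R a l, y) ∈ R l := by
  cases l with
  | zero => exact Or.inl rfl
  | succ l => exact rowBelow_eq_zero_or _ _

/-- The row extended in `ν_{l+1}` lies below the one extended in `ν_l`: either they have the same
length, or a single string of `ν_l` has length in between. -/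
theorem interlace_gap {μ ν : RP} {p q : ℕ} (hq : q = rowBelow ν p) (hlt : q < p)
    (hp : ∃ y, (p, y) ∈ μ)
    (hi : ∀ c, 1 ≤ c → colHt μ c ≤ colHt ν c ∧ colHt ν c ≤ colHt μ c + 1) :
    colHt μ (p + 1) + 1 ≤ colHt ν (p + 1) ∧ colHt ν (q + 1) ≤ colHt μ (q + 1) ∧
      colHt μ (q + 1) = colHt μ (p + 1) + 1 := by
  obtain ⟨y, hy⟩ := hp
  have hconst : ∀ c, q < c → c ≤ p + 1 → colHt ν c = colHt ν (p + 1) := by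
    refine fun c hc hcp => colHt_eq_of_forall hcp fun s hs hcs => ?_
    by_contra hsp
    have := le_rowBelow hs (L := p) (by omega)
    omega
  have h1 := colHt_succ_lt hy
  have h2 := hconst p hlt (by omega)
  have h3 := hconst (q + 1) (by omega) (by omega)
  have h4 := hi p (by omega)
  have h5 := hi (q + 1) (by omega)
  have h6 := hi (p + 1) (by omega)
  have h7 := colHt_anti μ (show q + 1 ≤ p by omega)
  omega

section Interval

variable {n m a₀ : ℕ} {T : ℕ → ℕ} {x : ℤ} {R : RC}

theorem Stable.row_le_snake (h : Stable n m a₀ T x R) {a : ℕ} (ha : 1 ≤ a) (ha₀ : a₀ ≤ a) {l : ℕ}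
    (hl : a ≤ l) : l ≤ m → T l ≤ snake R a l := by
  induction l, hl using Nat.le_induction with
  | base =>
    intro hm
    rcases h.row_mem a ha₀ hm with h0 | ⟨y, hy⟩
    · omega
    · rw [snake_start ha]
      exact le_rowBelow hy (le_topLen hy)
  | succ l hl ih =>
    intro hm
    rcases h.row_mem (l + 1) (by omega) hm with h0 | ⟨y, hy⟩
    · omega
    · rw [snake_succ hl]
      exact le_rowBelow hy ((h.row_anti l (by omega) (by omega)).trans (ih (by omega)))

/-- The common rigging of the long strings of `ν_l` in a stable configuration. -/
def levelAt (m : ℕ) (x : ℤ) (l : ℕ) : ℤ := if l = m then x else 0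

theorem Stable.levelAt (h : Stable n m a₀ T x R) {l : ℕ} (hl : l ≤ m) :
    Level (R l) (levelAt m x l) (T l) := by
  unfold CascRC.levelAt
  split_ifs with hlm
  · subst hlm; exact h.level
  · have hz := h.rig_zero l (by omega)
    exact ⟨le_rfl, fun s hs => (hz s hs).ge, fun s hs _ => hz s hs, fun _ => rfl⟩

/-- The configuration `S` obtained from `R` by the operators `f_a, …, f_l` of a lower subinterval
ending at `m`. -/
structure Partway (m : ℕ) (x : ℤ) (R : RC) (a l : ℕ) (S : RC) : Prop where
  pos : ∀ b, ∀ s ∈ S b, 0 < s.1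
  height : ∀ b c, 1 ≤ c → colHt (S b) c =
    colHt (R b) c + if (a ≤ b ∧ b ≤ l) ∧ c = snake R a b + 1 then 1 else 0
  rig_zero : ∀ b < l, ∀ s ∈ S b, s.2 = 0
  rig_self : ∀ s ∈ S l, (snake R a l < s.1 → s.2 = levelAt m x l - 1) ∧
    (s.1 ≤ snake R a l → s ∈ R l)
  next : S (l + 1) = bump (snake R a l) (R (l + 1))
  later : ∀ b, l + 1 < b → S b = R b

theorem Stable.partway_start (h : Stable n m a₀ T x R) {a : ℕ} (ha : 1 ≤ a) (ha₀ : a₀ ≤ a)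
    (ham : a ≤ m) : Partway m x R a a (fOp a R) := by
  have hT := h.row_le_snake ha ha₀ le_rfl ham
  have hlev := h.levelAt ham
  have hbump : R a = bump (topLen (R a)) (R a) := (bump_eq_self fun s hs => le_topLen hs).symm
  rw [snake_start ha] at hT
  have hsel := hlev.selects (h.pos a) hT
  rw [← hbump, ← snake_start ha] at hsel
  refine ⟨fOp_pos h.pos hsel, fun b c hc => ?_, fun b hb => ?_, ?_, ?_, fun b hb => ?_⟩
  · rw [colHt_fOp (h.pos a) hsel b c hc]
    congr 1
    by_cases hb : b = a
    · subst hb; simp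
    · rw [if_neg (by tauto), if_neg (by omega)]
  · have hz := h.rig_zero b (by omega)
    by_cases hb1 : a = b + 1
    · subst hb1
      rw [fOp_adj (h.pos _) hsel (Or.inr rfl), bump_eq_self]
      · exact hz
      · intro s hs
        by_contra hlt
        have h1 := (h.interlace b (by omega) s.1 (h.pos b s hs)).1
        have h2 := colHt_succ_lt (c := s.1) (y := s.2) hs
        have h3 : colHt (R (b + 1)) s.1 = 0 := by
          refine colHt_eq_zero_of_forall_lt fun t ht => ?_
          have := le_rowBelow ht (le_topLen ht)
          rw [← snake_start ha] at this
          omega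
        omega
    · rw [fOp_far (h.pos a) hsel (by omega) (by omega) hb1]
      exact hz
  · rw [snake_start ha]
    exact fOp_self hbump (h.pos a) hlev hT
  · exact fOp_adj (h.pos a) hsel (Or.inl rfl)
  · exact fOp_far (h.pos a) hsel (by omega) (by omega) (by omega)

theorem Stable.partway_succ (h : Stable n m a₀ T x R) {a : ℕ} (ha : 1 ≤ a) (ha₀ : a₀ ≤ a)
    {l : ℕ} (hal : a ≤ l) (hlm : l < m) {S : RC} (hS : Partway m x R a l S) :
    Partway m x R a (l + 1) (fOp (l + 1) S) := by
  have hT := h.row_le_snake ha ha₀ (Nat.le_succ_of_le hal) hlm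
  have hlev := h.levelAt (Nat.succ_le_of_lt hlm)
  have hle : snake R a (l + 1) ≤ snake R a l := by
    rw [snake_succ hal]; exact rowBelow_le _ _
  have hT' := hT
  rw [Nat.succ_eq_add_one, snake_succ hal] at hT'
  have hsel := hlev.selects (h.pos (l + 1)) hT'
  rw [← snake_succ hal, ← hS.next] at hsel
  have hp := hS.pos (l + 1)
  refine ⟨fOp_pos hS.pos hsel, fun b c hc => ?_, fun b hb => ?_, ?_, ?_, fun b hb => ?_⟩
  · rw [colHt_fOp hp hsel b c hc, hS.height b c hc, add_assoc]
    congr 1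
    by_cases hb : b = l + 1
    · subst hb
      rw [if_neg (by omega)]
      simp [Nat.le_succ_of_le hal]
    · rw [if_neg (c := b = l + 1 ∧ _) (by tauto), add_zero]
      refine if_congr ?_ rfl rfl
      have : b ≤ l ↔ b ≤ l + 1 := by omega
      rw [this]
  · by_cases hbl : b = l
    · subst hbl
      rw [fOp_adj hp hsel (Or.inr rfl)]
      intro s hs
      obtain ⟨t, ht, rfl⟩ := Multiset.mem_map.1 hs
      obtain ⟨h1, h2⟩ := hS.rig_self t ht
      rw [CascRC.levelAt, if_neg (by omega)] at h1
      by_cases hlong : snake R a b < t.1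
      · have := h1 hlong
        rw [if_pos (by omega)]
        simp only
        omega
      · have hz := h.rig_zero b hlm t (h2 (not_lt.1 hlong))
        rw [if_neg]
        · exact hz
        · intro hgap
          have hlt : snake R a (b + 1) < snake R a b := by omega
          have hg := interlace_gap (snake_succ hal) hlt
            ((snake_eq_zero_or R a b).resolve_left (by omega)) (h.interlace b hlm)
          have e1 := hS.height b (snake R a (b + 1) + 1) (by omega)
          have e2 := hS.height b (snake R a b + 1) (by omega)
          rw [if_neg (by omega)] at e1
          rw [if_pos (by omega)] at e2
          have := le_of_colHt_le (ν := S b) (show snake R a (b + 1) + 1 ≤ snake R a b + 1 by omega)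
            (by omega) t ht hgap
          omega
    · rw [fOp_far hp hsel (by omega) (by omega) (by omega)]
      exact hS.rig_zero b (by omega)
  · rw [snake_succ hal]
    exact fOp_self hS.next (h.pos (l + 1)) hlev hT'
  · rw [fOp_adj hp hsel (Or.inl rfl), hS.later _ (by omega)]
  · rw [fOp_far hp hsel (by omega) (by omega) (by omega), hS.later _ (by omega)]

theorem fList_lowerInt_self (a : ℕ) (R : RC) : fList (lowerInt a a) R = fOp a R := by
  simp [fList, lowerInt]

theorem fList_lowerInt_succ {a l : ℕ} (h : a ≤ l) (R : RC) :
    fList (lowerInt a (l + 1)) R = fOp (l + 1) (fList (lowerInt a l) R) := by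
  have h1 : l + 1 + 1 - a = (l + 1 - a) + 1 := by omega
  have h2 : a + (l + 1 - a) = l + 1 := by omega
  rw [fList, lowerInt, h1, List.range'_1_concat, List.foldl_append, h2]
  rfl

theorem Stable.partway (h : Stable n m a₀ T x R) {a : ℕ} (ha : 1 ≤ a) (ha₀ : a₀ ≤ a) {l : ℕ}
    (hl : a ≤ l) : l ≤ m → Partway m x R a l (fList (lowerInt a l) R) := by
  induction l, hl using Nat.le_induction with
  | base =>
    intro hm
    rw [fList_lowerInt_self]
    exact h.partway_start ha ha₀ hm
  | succ l hl ih =>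
    intro hm
    rw [fList_lowerInt_succ hl]
    exact h.partway_succ ha ha₀ hl hm (ih (by omega))

theorem Stable.interval (h : Stable n m a₀ T x R) {a : ℕ} (ha : 1 ≤ a) (ha₀ : a₀ ≤ a)
    (ham : a ≤ m) :
    Stable n m a (fun l => snake R a l + 1) (x - 1) (fList (lowerInt a m) R) := by
  have hS := h.partway ha ha₀ ham le_rfl
  set S := fList (lowerInt a m) R
  have hinter : ∀ l < m, ∀ c, 1 ≤ c →
      colHt (S l) c ≤ colHt (S (l + 1)) c ∧ colHt (S (l + 1)) c ≤ colHt (S l) c + 1 := by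
    intro l hl c hc
    have hi := h.interlace l hl c hc
    rw [hS.height l c hc, hS.height (l + 1) c hc]
    by_cases hal : a ≤ l
    · have hle : snake R a (l + 1) ≤ snake R a l := by
        rw [snake_succ hal]; exact rowBelow_le _ _
      rcases hle.eq_or_lt with heq | hlt
      · rw [heq]
        split_ifs <;> omega
      · have hg := interlace_gap (snake_succ hal) hlt
          ((snake_eq_zero_or R a l).resolve_left (by omega)) (h.interlace l hl)
        split_ifs with h1 h2 h2
        · omega
        · rw [h1.2] at hi ⊢; omega
        · rw [h2.2] at hi ⊢; omega
        · omega
    · rw [if_neg (by omega)]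
      split_ifs with h1
      · have hla : l + 1 = a := by omega
        have h0 : colHt (R (l + 1)) c = 0 := by
          refine colHt_eq_zero_of_forall_lt fun t ht => ?_
          have := le_rowBelow ht (le_topLen ht)
          rw [hla, ← snake_start ha] at this
          rw [h1.2, hla]
          omega
        omega
      · omega
  have hrow : ∀ l, l ≤ m → colHt (S l) 1 ≤ l := by
    intro l
    induction l with
    | zero =>
      intro _
      have := h.rows_le 0
      rw [hS.height 0 1 le_rfl, if_neg (by omega)]
      exact this
    | succ l ih =>
      intro hl
      have := ih (by omega)
      have := (hinter l hl 1 le_rfl).2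
      omega
  refine ⟨hS.pos, hinter, hS.rig_zero, ⟨?_, ?_, ?_, ?_⟩, ?_, ?_, ?_, ?_, ?_⟩
  · have := h.level.nonpos; omega
  · intro s hs
    obtain ⟨h1, h2⟩ := hS.rig_self s hs
    rw [CascRC.levelAt, if_pos rfl] at h1
    by_cases hlong : snake R a m < s.1
    · exact (h1 hlong).ge
    · have := h.level.ge s (h2 (not_lt.1 hlong)); omega
  · intro s hs hlong
    have := (hS.rig_self s hs).1 hlong
    rwa [CascRC.levelAt, if_pos rfl] at this
  · simp
  · intro l hal hlm
    right
    by_contra hno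
    push Not at hno
    have h1 := hS.height l (snake R a l + 1) (by omega)
    have h2 := hS.height l (snake R a l + 1 + 1) (by omega)
    rw [if_pos (by omega)] at h1
    rw [if_neg (by omega)] at h2
    have h3 := colHt_anti (R l) (Nat.le_succ (snake R a l + 1))
    have h4 : colHt (S l) (snake R a l + 1) = colHt (S l) (snake R a l + 1 + 1) := by
      refine colHt_eq_of_forall (by omega) fun s hs hle => ?_
      by_contra hlt
      have hs1 : s.1 = snake R a l + 1 := by omega
      exact hno s.2 (hs1 ▸ hs)
    simp only [Nat.succ_eq_add_one] at h3
    omega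
  · intro l hal _
    rw [snake_succ hal]
    have := rowBelow_le (R (l + 1)) (snake R a l)
    omega
  · intro l
    by_cases hlm : l ≤ m
    · exact hrow l hlm
    · rw [hS.height l 1 le_rfl, if_neg (by omega)]
      exact h.rows_le l
  · intro l hl
    have h1 := h.rows_le_sub l hl
    rw [hS.height l 1 le_rfl]
    split_ifs with hnew
    · have hT := h.row_le_snake ha ha₀ hnew.1.1 hnew.1.2
      have := h.rows_fresh l (by omega) hnew.1.2 (by omega)
      omega
    · omega
  · simp

end Interval

theorem stable_rows {n m a : ℕ} {T : ℕ → ℕ} {x : ℤ} {R : RC} (h : Stable n m a T x R)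
    (hm : m ≤ n) (ivs : List (ℕ × ℕ)) (hiv : ∀ p ∈ ivs, IsLowerIv n p)
    (hch : ((a, m) :: ivs).IsChain CascCh) :
    ∀ l, l ≤ n → (fList (seqOf ivs) R l).card ≤ min (n - l + 1) l := by
  induction ivs generalizing m a T x R with
  | nil =>
    intro l hl
    have h1 := h.rows_le l
    have h2 := h.rows_le_sub l hl
    rw [colHt_one (h.pos l)] at h1 h2
    change (R l).card ≤ _
    omega
  | cons p ps ih =>
    obtain ⟨b, k⟩ := p
    obtain ⟨hb, hbk, hk⟩ := hiv (b, k) (by simp)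
    obtain ⟨hpq, htail⟩ := List.isChain_cons_cons.1 hch
    have hseq : fList (seqOf ((b, k) :: ps)) R = fList (seqOf ps) (fList (lowerInt b k) R) := by
      simp [fList, seqOf]
    rw [hseq]
    have hps : ∀ q ∈ ps, IsLowerIv n q := fun q hq => hiv q (List.mem_cons_of_mem _ hq)
    rcases hpq with hlt | ⟨heq, hab⟩
    · exact ih ((h.descend hlt hm).interval hb (Nat.zero_le b) hbk) hk hps htail
    · simp only at hb hbk hk heq hab
      subst heq
      exact ih (h.interval hb hab hbk) hk hps htail

/-- Lemma "max rows".
If `α` is a cascading `n`-sequence and `RC(α) = (ν₁, …, ν_n)`, then `ν_l` has at most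
`min (n - l + 1) l` strings (rows). -/
theorem max_rows (n : ℕ) (hn : 0 < n)
    (ivs : List (ℕ × ℕ)) (hc : IsCascDecomp n ivs) :
    ∀ l, 1 ≤ l → l ≤ n →
      (RCseq (seqOf ivs) l).card ≤ min (n - l + 1) l := by
  intro l _ hl
  refine stable_rows (stable_empty n) le_rfl ivs hc.1 ?_ l hl
  obtain ⟨hiv, hch⟩ := hc
  cases ivs with
  | nil => simp
  | cons p ps =>
    refine List.isChain_cons_cons.2 ⟨?_, hch⟩
    rcases (hiv p (by simp)).2.2.lt_or_eq with hlt | heq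
    · exact Or.inl hlt
    · exact Or.inr ⟨heq, Nat.zero_le _⟩

end CascRC
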